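/- There is a constant C > 0 (depending on D) such that for every nonzero ideal 𝔞 ⊆ O_D with N(𝔞) > C, every element γ ∈ Γ(𝔞) that fixes some point η ∈ ℙ¹(F) has trace 2; equivalently, every such γ is unipotent, i.e. (γ − Id)² = 0. -/

import Mathlib

open scoped MatrixGroups

set_option maxHeartbeats 1000000
set_option synthInstance.maxHeartbeats 400000

noncomputable section

namespace Bianchi

open NumberField MvPolynomial Finsupp

/-- `√(-D)` as a complex number. -/
def sqrtNeg (D : ℕ) : ℂ := Complex.I * (Real.sqrt D : ℂ)

lemma sqrtNeg_sq (D : ℕ) : sqrtNeg D ^ 2 = -(D : ℂ) := by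
  have h : ((Real.sqrt D : ℝ) : ℂ) ^ 2 = (D : ℂ) := by
    norm_cast
    exact_mod_cast Real.sq_sqrt (by positivity : (0:ℝ) ≤ (D:ℝ))
  simp [sqrtNeg, mul_pow, Complex.I_sq, h]

/-- The imaginary quadratic field `F = ℚ(√-D)`, realized inside `ℂ`. -/
def F (D : ℕ) : IntermediateField ℚ ℂ := IntermediateField.adjoin ℚ {sqrtNeg D}

lemma isIntegral_sqrtNeg (D : ℕ) : IsIntegral ℚ (sqrtNeg D) := by
  refine ⟨Polynomial.X ^ 2 + Polynomial.C (D : ℚ), Polynomial.monic_X_pow_add_C _ (by norm_num), ?_⟩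
  simp [Polynomial.eval₂, sqrtNeg_sq]

instance (D : ℕ) : FiniteDimensional ℚ (F D) :=
  IntermediateField.adjoin.finiteDimensional (isIntegral_sqrtNeg D)

instance (D : ℕ) : NumberField (F D) := ⟨⟩

/-- The principal congruence subgroup `Γ(𝔞)` of the Bianchi group `Γ(D) = SL(2, O_D)`:
the matrices that are congruent to the identity modulo `𝔞` entrywise, i.e. the kernel of
entrywise reduction mod `𝔞`. -/
def Gamma (D : ℕ) (𝔞 : Ideal (𝓞 (F D))) : Subgroup SL(2, 𝓞 (F D)) :=
  (Matrix.SpecialLinearGroup.map (Ideal.Quotient.mk 𝔞)).ker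

/-- A congruence subgroup of the Bianchi group: a subgroup containing some `Γ(𝔞)`, `𝔞 ≠ 0`. -/
def IsCongruence (D : ℕ) (Γ : Subgroup SL(2, 𝓞 (F D))) : Prop :=
  ∃ 𝔞 : Ideal (𝓞 (F D)), 𝔞 ≠ ⊥ ∧ Gamma D 𝔞 ≤ Γ

/-- The projective line `ℙ¹(F)`. -/
abbrev P1 (D : ℕ) := Projectivization (F D) (Fin 2 → F D)

section P1action

variable {K : Type*} [Field K]

lemma toLin'_injective (g : SL(2, K)) :
    Function.Injective (Matrix.toLin' (g : Matrix (Fin 2) (Fin 2) K)) := by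
  intro x y h
  have h2 : ∀ v : Fin 2 → K,
      Matrix.toLin' ((g⁻¹ : SL(2,K)) : Matrix (Fin 2) (Fin 2) K)
        (Matrix.toLin' (g : Matrix (Fin 2) (Fin 2) K) v) = v := by
    intro v
    rw [← Matrix.toLin'_mul_apply, ← Matrix.SpecialLinearGroup.coe_mul, inv_mul_cancel,
      Matrix.SpecialLinearGroup.coe_one, Matrix.toLin'_one, LinearMap.id_apply]
  rw [← h2 x, ← h2 y, h]

/-- The action of `SL₂` on the projective line by linear fractional transformations. -/
instance instSMulSL : SMul (SL(2,K)) (Projectivization K (Fin 2 → K)) :=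
  ⟨fun g x => Projectivization.map
      ((Matrix.toLin' (g : Matrix (Fin 2) (Fin 2) K)) : (Fin 2 → K) →ₗ[K] (Fin 2 → K))
      (toLin'_injective g) x⟩

lemma smul_mk (g : SL(2,K)) (v : Fin 2 → K) (hv : v ≠ 0) :
    g • Projectivization.mk K v hv =
      Projectivization.mk K (Matrix.toLin' (g : Matrix (Fin 2) (Fin 2) K) v)
        (by simpa using (toLin'_injective g).ne_iff' (map_zero _) |>.2 hv) := rfl

instance instMulActionSL : MulAction (SL(2,K)) (Projectivization K (Fin 2 → K)) where
  one_smul x := by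
    induction x using Projectivization.ind with
    | h v hv =>
      rw [smul_mk]
      simp only [Matrix.SpecialLinearGroup.coe_one, Matrix.toLin'_one, LinearMap.id_apply]
  mul_smul g h x := by
    induction x using Projectivization.ind with
    | h v hv =>
      rw [smul_mk, smul_mk, smul_mk]
      simp only [Matrix.SpecialLinearGroup.coe_mul, Matrix.toLin'_mul, LinearMap.comp_apply]

lemma e10_ne (K : Type*) [Field K] : (![1, 0] : Fin 2 → K) ≠ 0 := by
  intro h
  have := congrFun h 0
  simp at this

/-- The point `∞ = [1 : 0]` of the projective line. -/
def infty (K : Type*) [Field K] : Projectivization K (Fin 2 → K) :=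
  Projectivization.mk K ![1, 0] (e10_ne K)

end P1action

/-- The inclusion `SL(2, O_D) → SL(2, F)`. -/
def toSLF (D : ℕ) : SL(2, 𝓞 (F D)) →* SL(2, F D) :=
  Matrix.SpecialLinearGroup.map (algebraMap (𝓞 (F D)) (F D))

/-- The action of the Bianchi group on `ℙ¹(F)`. -/
instance (D : ℕ) : MulAction (SL(2, 𝓞 (F D))) (P1 D) :=
  MulAction.compHom _ (toSLF D)

/-- The number of cusps of a subgroup of the Bianchi group:
the number of its orbits on `ℙ¹(F)`. -/
def cusps (D : ℕ) (Γ : Subgroup SL(2, 𝓞 (F D))) : ℕ :=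
  Nat.card (MulAction.orbitRel.Quotient Γ (P1 D))

lemma norm_algHom_apply (D : ℕ) (σ : F D →ₐ[ℚ] ℂ) (x : F D) : ‖σ x‖ = ‖(x : ℂ)‖ := by
  set s : F D := ⟨sqrtNeg D, IntermediateField.mem_adjoin_simple_self ℚ _⟩
  have hs2 : s ^ 2 = -(D : F D) := by
    apply Subtype.ext
    simpa using sqrtNeg_sq D
  have hσ : σ s ^ 2 = sqrtNeg D ^ 2 := by
    rw [← map_pow, hs2, sqrtNeg_sq]
    simp
  have hconj : (starRingEnd ℂ) (sqrtNeg D) = -sqrtNeg D := by simp [sqrtNeg]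
  rcases sq_eq_sq_iff_eq_or_eq_neg.1 hσ with h | h
  · have : σ = (F D).val := by
      refine IntermediateField.algHom_ext_of_eq_adjoin (S := F D) (s := {sqrtNeg D}) ℚ rfl ?_
      rintro y hy
      obtain rfl := Set.mem_singleton_iff.1 hy
      exact h
    rw [this]; rfl
  · have : σ = ((starRingEnd ℂ).toRatAlgHom).comp (F D).val := by
      refine IntermediateField.algHom_ext_of_eq_adjoin (S := F D) (s := {sqrtNeg D}) ℚ rfl ?_
      rintro y hy
      obtain rfl := Set.mem_singleton_iff.1 hy
      exact h.trans hconj.symm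
    rw [this]
    exact RCLike.norm_conj (x : ℂ)

lemma abs_norm_eq_pow (D : ℕ) (x : F D) :
    |((Algebra.norm ℚ x : ℚ) : ℝ)| = ‖(x : ℂ)‖ ^ Module.finrank ℚ (F D) := by
  have h := congrArg (‖·‖) (Algebra.norm_eq_prod_embeddings ℚ ℂ x)
  simp only [norm_prod, norm_algHom_apply, Finset.prod_const, Finset.card_univ,
    AlgHom.card ℚ (F D) ℂ] at h
  rw [← h, eq_ratCast]
  norm_cast

lemma norm_unit_eq_one (D : ℕ) (u : (𝓞 (F D))ˣ) : ‖(((u : 𝓞 (F D)) : F D) : ℂ)‖ = 1 := by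
  have h := abs_norm_eq_pow D ((u : 𝓞 (F D)) : F D)
  have h1 : |((Algebra.norm ℚ ((u : 𝓞 (F D)) : F D) : ℚ) : ℝ)| = 1 := by
    have := (NumberField.isUnit_iff_norm (K := F D) (x := (u : 𝓞 (F D)))).1 u.isUnit
    rw [RingOfIntegers.coe_norm] at this
    exact_mod_cast this
  rw [h1] at h
  exact (pow_eq_one_iff_of_nonneg (norm_nonneg _) Module.finrank_pos.ne').1 h.symm

lemma exists_eigenvalue_of_smul_eq (D : ℕ) (γ : SL(2, 𝓞 (F D))) (η : P1 D) (h : γ • η = η) :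
    ∃ u : (𝓞 (F D))ˣ, (u : 𝓞 (F D)) + ((u⁻¹ : (𝓞 (F D))ˣ) : 𝓞 (F D)) =
      Matrix.trace (γ : Matrix (Fin 2) (Fin 2) (𝓞 (F D))) := by
  induction η using Projectivization.ind with
  | h v hv =>
    change toSLF D γ • Projectivization.mk (F D) v hv = _ at h
    rw [smul_mk, Projectivization.mk_eq_mk_iff'] at h
    obtain ⟨c, hc⟩ := h
    set A : Matrix (Fin 2) (Fin 2) (F D) := (toSLF D γ : Matrix (Fin 2) (Fin 2) (F D))
    have hdet : (A - c • (1 : Matrix (Fin 2) (Fin 2) (F D))).det = 0 := by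
      refine Matrix.exists_mulVec_eq_zero_iff.1 ⟨v, hv, ?_⟩
      rw [Matrix.toLin'_apply] at hc
      rw [Matrix.sub_mulVec, Matrix.smul_mulVec, Matrix.one_mulVec, hc, sub_self]
    have hA1 : A.det = 1 := (toSLF D γ).2
    set t := Matrix.trace (γ : Matrix (Fin 2) (Fin 2) (𝓞 (F D))) with ht
    have htr : A 0 0 + A 1 1 = (t : F D) := by
      rw [ht, Matrix.trace_fin_two]
      exact (map_add (algebraMap (𝓞 (F D)) (F D)) _ _).symm
    rw [Matrix.det_fin_two] at hdet hA1
    simp at hdet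
    have key : c * ((t : F D) - c) = 1 := by
      linear_combination -hdet + hA1 - c * htr
    have hint : IsIntegral (𝓞 (F D)) c := by
      refine ⟨Polynomial.X ^ 2 - Polynomial.C t * Polynomial.X + 1, by monicity!, ?_⟩
      simp [Polynomial.eval₂_sub, Polynomial.eval₂_add]
      linear_combination -key
    obtain ⟨l, rfl⟩ := IsIntegrallyClosed.isIntegral_iff.1 hint
    have key' : l * (t - l) = 1 := by
      apply RingOfIntegers.coe_injective
      simpa using key
    refine ⟨⟨l, t - l, key', by rw [mul_comm, key']⟩, ?_⟩
    simp

lemma two_sub_trace_mem (D : ℕ) (𝔞 : Ideal (𝓞 (F D))) (γ : SL(2, 𝓞 (F D)))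
    (hγ : γ ∈ Gamma D 𝔞) :
    2 - Matrix.trace (γ : Matrix (Fin 2) (Fin 2) (𝓞 (F D))) ∈ 𝔞 := by
  have h : Matrix.SpecialLinearGroup.map (Ideal.Quotient.mk 𝔞) γ = 1 := hγ
  have h' (i : Fin 2) : Ideal.Quotient.mk 𝔞 (γ i i) = 1 := by
    have := congrArg (fun g : SL(2, 𝓞 (F D) ⧸ 𝔞) => g i i) h
    simpa using this
  rw [← Ideal.Quotient.eq_zero_iff_mem, Matrix.trace_fin_two, map_sub, map_add, h', h', map_ofNat]
  ring

lemma sub_one_sq_eq_zero_of_trace_eq_two {R : Type*} [CommRing R] (γ : SL(2, R))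
    (h : Matrix.trace (γ : Matrix (Fin 2) (Fin 2) R) = 2) :
    ((γ : Matrix (Fin 2) (Fin 2) R) - 1) ^ 2 = 0 := by
  have hd : (γ : Matrix (Fin 2) (Fin 2) R).det = 1 := γ.2
  rw [Matrix.det_fin_two] at hd
  rw [Matrix.trace_fin_two] at h
  rw [sq]
  ext i j
  fin_cases i <;> fin_cases j <;> simp [Matrix.mul_apply, Fin.sum_univ_two]
  · linear_combination γ 0 0 * h - hd
  · linear_combination γ 0 1 * h
  · linear_combination γ 1 0 * h
  · linear_combination γ 1 1 * h - hd

/-- For `N(𝔞)` sufficiently large, every `γ ∈ Γ(𝔞)` fixing a point of `ℙ¹(F)`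
has trace `2` and is unipotent. -/
theorem statement_8 (D : ℕ) (hD : Squarefree D) (hD0 : 0 < D) :
    ∃ C : ℝ, 0 < C ∧ ∀ 𝔞 : Ideal (𝓞 (F D)), 𝔞 ≠ ⊥ → C < (Ideal.absNorm 𝔞 : ℝ) →
      ∀ γ : SL(2, 𝓞 (F D)), γ ∈ Gamma D 𝔞 → (∃ η : P1 D, γ • η = η) →
        Matrix.trace (γ : Matrix (Fin 2) (Fin 2) (𝓞 (F D))) = 2 ∧
        ((γ : Matrix (Fin 2) (Fin 2) (𝓞 (F D))) - 1) ^ 2 = 0 := by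
  refine ⟨4 ^ Module.finrank ℚ (F D), by positivity, ?_⟩
  rintro 𝔞 - hC γ hγ ⟨η, hη⟩
  suffices h : Matrix.trace (γ : Matrix (Fin 2) (Fin 2) (𝓞 (F D))) = 2 from
    ⟨h, sub_one_sq_eq_zero_of_trace_eq_two γ h⟩
  obtain ⟨u, hu⟩ := exists_eigenvalue_of_smul_eq D γ η hη
  have hmem := two_sub_trace_mem D 𝔞 γ hγ
  set t := Matrix.trace (γ : Matrix (Fin 2) (Fin 2) (𝓞 (F D)))
  by_contra hne
  have hx : (2 - t) ≠ 0 := fun h => hne (sub_eq_zero.1 h).symm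
  have hdvd : (Ideal.absNorm 𝔞 : ℤ) ∣ Algebra.norm ℤ (2 - t) := Ideal.absNorm_dvd_norm_of_mem hmem
  have hle : (Ideal.absNorm 𝔞 : ℤ) ≤ |Algebra.norm ℤ (2 - t)| :=
    Int.le_of_dvd (abs_pos.2 (Algebra.norm_ne_zero_iff.2 hx)) ((dvd_abs _ _).2 hdvd)
  have hle' : (Ideal.absNorm 𝔞 : ℝ) ≤ |((Algebra.norm ℚ ((2 - t : 𝓞 (F D)) : F D) : ℚ) : ℝ)| := by
    rw [← Algebra.coe_norm_int]
    exact_mod_cast hle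
  rw [abs_norm_eq_pow] at hle'
  have hbound : ‖(((2 - t : 𝓞 (F D)) : F D) : ℂ)‖ ≤ 4 := by
    have e : (((2 - t : 𝓞 (F D)) : F D) : ℂ) = 2 - (((u : 𝓞 (F D)) : F D) : ℂ)
        - ((((u⁻¹ : (𝓞 (F D))ˣ) : 𝓞 (F D)) : F D) : ℂ) := by
      rw [← hu, sub_sub]
      push_cast
      rfl
    rw [e]
    refine (norm_sub_le _ _).trans ?_
    refine (add_le_add_left (norm_sub_le _ _) _).trans ?_
    rw [norm_unit_eq_one, norm_unit_eq_one]
    norm_num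
  exact hC.not_ge (hle'.trans (pow_le_pow_left₀ (norm_nonneg _) hbound _))

end Bianchi
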